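/- Let S be a convex compact subset of ℝ^M and f : ℝ^M → ℝ^M Lipschitz on S with constant L, satisfying the one-sided Lipschitz condition on S with constant λ < 0. Set C = sup_{y∈S} L·‖f(y)‖, let e₀ > 0, G = √3·e₀·|λ|/C, α = 1 + |λ|·G/4 − √(1 + (λ·G/4)²), and suppose |λ|·G/4 < 1. Let Δt ∈ (0, G·(1−α)], let y : [0, n·Δt] → S solve y′(t) = f(y(t)), and define the iterated Euler points z_{j+1} = z_j + Δt·f(z_j), assumed to remain in S, with ‖y(0) − z₀‖ ≤ e₀. Then for every j = 0, 1, …, n: ‖y(j·Δt) − z_j‖ ≤ e₀ (subsampling: the Euler error never exceeds the initial error bound e₀ at each step). -/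

import Mathlib

open Set Real
open scoped RealInnerProductSpace

lemma aux_norm_le {V : Type*} [NormedAddCommGroup V] [InnerProductSpace ℝ V]
    (E E' : ℝ → V) (T mu C e₀ : ℝ) (hT : 0 ≤ T) (hmu : 0 < mu) (hC : 0 ≤ C) (he : 0 < e₀)
    (hE : ∀ t ∈ Icc (0 : ℝ) T, HasDerivAt E (E' t) t)
    (hin : ∀ t ∈ Icc (0 : ℝ) T, ⟪E' t, E t⟫ ≤ -mu * ‖E t‖ ^ 2 + C * t * ‖E t‖)
    (h0 : ‖E 0‖ ≤ e₀) :
    ‖E T‖ ≤ e₀ * exp (-(mu * T)) + C / mu ^ 2 * (mu * T - 1 + exp (-(mu * T))) := by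
  set p : ℝ → ℝ := fun t => e₀ * exp (-(mu * t)) + C / mu ^ 2 * (mu * t - 1 + exp (-(mu * t)))
    with hp
  have hpos : ∀ t, 0 < p t := by
    intro t
    have h1 := Real.add_one_le_exp (-(mu * t))
    have h2 : 0 ≤ C / mu ^ 2 * (mu * t - 1 + exp (-(mu * t))) :=
      mul_nonneg (by positivity) (by linarith)
    have h3 : 0 < e₀ * exp (-(mu * t)) := by positivity
    simp only [hp]; linarith
  have hexp : ∀ t, HasDerivAt (fun t => exp (-(mu * t))) (-mu * exp (-(mu * t))) t := by
    intro t
    have h1 : HasDerivAt (fun t : ℝ => -(mu * t)) (-mu) t := by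
      simpa using ((hasDerivAt_id' t).const_mul mu).fun_neg
    have := h1.exp
    rwa [mul_comm] at this
  have hexp' : ∀ t, HasDerivAt (fun t => exp (mu * t)) (mu * exp (mu * t)) t := by
    intro t
    have h1 : HasDerivAt (fun t : ℝ => mu * t) mu t := by
      simpa using (hasDerivAt_id' t).const_mul mu
    have := h1.exp
    rwa [mul_comm] at this
  have hpd : ∀ t, HasDerivAt p (-mu * p t + C * t) t := by
    intro t
    have := ((hexp t).const_mul e₀).fun_add
      (((((hasDerivAt_id' t).const_mul mu).sub_const 1).fun_add (hexp t)).const_mul (C / mu ^ 2))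
    refine this.congr_deriv ?_
    change _ = -mu * (e₀ * exp (-(mu * t)) + C / mu ^ 2 * (mu * t - 1 + exp (-(mu * t)))) + C * t
    field_simp
    ring
  have hu : ∀ t ∈ Icc (0 : ℝ) T, HasDerivAt (fun t => ‖E t‖ ^ 2) (2 * ⟪E t, E' t⟫) t :=
    fun t ht => (hE t ht).norm_sq
  have hh : ∀ t ∈ Icc (0 : ℝ) T, HasDerivAt
      (fun t => exp (mu * t) * (‖E t‖ ^ 2 / p t - p t))
      (mu * exp (mu * t) * (‖E t‖ ^ 2 / p t - p t) + exp (mu * t) *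
        ((2 * ⟪E t, E' t⟫ * p t - ‖E t‖ ^ 2 * (-mu * p t + C * t)) / p t ^ 2
          - (-mu * p t + C * t))) t :=
    fun t ht => (hexp' t).mul (((hu t ht).div (hpd t) (hpos t).ne').sub (hpd t))
  have hanti : AntitoneOn (fun t => exp (mu * t) * (‖E t‖ ^ 2 / p t - p t)) (Icc 0 T) := by
    apply antitoneOn_of_deriv_nonpos (convex_Icc 0 T)
    · exact fun t ht => (hh t ht).continuousAt.continuousWithinAt
    · intro t ht
      rw [interior_Icc] at ht
      exact (hh t (Ioo_subset_Icc_self ht)).differentiableAt.differentiableWithinAt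
    · intro t ht
      rw [interior_Icc] at ht
      have ht' := Ioo_subset_Icc_self ht
      rw [(hh t ht').deriv]
      have hi := hin t ht'
      rw [real_inner_comm] at hi
      have hq := hpos t
      generalize p t = q at hq
      generalize ⟪E t, E' t⟫ = s at hi
      generalize ‖E t‖ = v at hi
      have hCt : 0 ≤ C * t := mul_nonneg hC ht.1.le
      have key : mu * exp (mu * t) * (v ^ 2 / q - q) + exp (mu * t) *
        ((2 * s * q - v ^ 2 * (-mu * q + C * t)) / q ^ 2 - (-mu * q + C * t))
        = - (exp (mu * t) / q ^ 2 * (2 * q * (-mu * v ^ 2 + C * t * v - s)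
            + C * t * (v - q) ^ 2)) := by
        field_simp
        ring
      rw [key]
      have : 0 ≤ -mu * v ^ 2 + C * t * v - s := by linarith
      have : 0 ≤ exp (mu * t) / q ^ 2 * (2 * q * (-mu * v ^ 2 + C * t * v - s)
            + C * t * (v - q) ^ 2) := by positivity
      linarith
  have h1 := hanti (left_mem_Icc.2 hT) (right_mem_Icc.2 hT) hT
  have hp0 : p 0 = e₀ := by simp [hp]
  have h2 : exp (mu * 0) * (‖E 0‖ ^ 2 / p 0 - p 0) ≤ 0 := by
    rw [hp0]
    have : ‖E 0‖ ^ 2 / e₀ ≤ e₀ := by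
      rw [div_le_iff₀ he]; nlinarith [norm_nonneg (E 0)]
    simp; linarith
  have h3 : exp (mu * T) * (‖E T‖ ^ 2 / p T - p T) ≤ 0 := h1.trans h2
  have h4 : ‖E T‖ ^ 2 / p T - p T ≤ 0 := by
    by_contra hcon
    push Not at hcon
    have := mul_pos (exp_pos (mu * T)) hcon
    linarith
  have h5 : ‖E T‖ ^ 2 / p T ≤ p T := by linarith
  rw [div_le_iff₀ (hpos T)] at h5
  change ‖E T‖ ≤ p T
  exact abs_le_of_sq_le_sq' (by linarith [sq (p T)]) (hpos T).le |>.2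

lemma aux_core (x g r K e₀ : ℝ) (hx : 0 < x) (hrpos : 0 < r) (hgp : 0 < g)
    (hxg : x ≤ g * (√(1 + (g / 4) ^ 2) - g / 4)) (hg2 : g ^ 2 = 3 * r ^ 2)
    (hK : K * r = e₀) (hKpos : 0 < K) :
    e₀ * exp (-x) + K * (x - 1 + exp (-x)) ≤ e₀ := by
  have hs : √(1 + (g / 4) ^ 2) ^ 2 = 1 + (g / 4) ^ 2 := Real.sq_sqrt (by positivity)
  generalize √(1 + (g / 4) ^ 2) = s at hs hxg
  have h1 : (x + g ^ 2 / 4) ^ 2 ≤ (g * s) ^ 2 := by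
    apply pow_le_pow_left₀ (by positivity)
    nlinarith
  have h2 : x ^ 2 ≤ 3 * r ^ 2 * (1 - x / 2) := by
    rw [← hg2]
    have : (g * s) ^ 2 = g ^ 2 * (1 + (g / 4) ^ 2) := by rw [mul_pow, hs]
    nlinarith
  have hx2 : 0 < 1 - x / 2 := by
    by_contra hcon
    push Not at hcon
    nlinarith [mul_nonneg (by positivity : 0 ≤ 3 * r ^ 2) (by linarith : 0 ≤ -(1 - x / 2)),
      sq_pos_of_pos hx]
  have h3 : 3 * (1 - x / 2) * (1 + x) ^ 2 ≤ (2 + x) ^ 2 := by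
    have : 0 ≤ x ^ 3 := by positivity
    nlinarith [sq_nonneg (x - 1 / 4)]
  have h4 : 3 * (1 - x / 2) * (x * (1 + x)) ^ 2 ≤ 3 * (1 - x / 2) * (r * (2 + x)) ^ 2 := by
    calc 3 * (1 - x / 2) * (x * (1 + x)) ^ 2 = x ^ 2 * (3 * (1 - x / 2) * (1 + x) ^ 2) := by ring
      _ ≤ x ^ 2 * (2 + x) ^ 2 := by gcongr
      _ ≤ (3 * r ^ 2 * (1 - x / 2)) * (2 + x) ^ 2 := by gcongr
      _ = _ := by ring
  have h5 : x * (1 + x) ≤ r * (2 + x) := by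
    have := le_of_mul_le_mul_left h4 (by positivity)
    exact abs_le_of_sq_le_sq' this (by positivity) |>.2
  have hq : exp (-x) * (1 + x + x ^ 2 / 2) ≤ 1 := by
    have := Real.quadratic_le_exp_of_nonneg hx.le
    calc exp (-x) * (1 + x + x ^ 2 / 2) ≤ exp (-x) * exp x := by gcongr
      _ = 1 := by rw [← exp_add]; simp
  have hqp := exp_pos (-x)
  have hq1 : exp (-x) ≤ 1 := by rw [Real.exp_le_one_iff]; linarith
  generalize exp (-x) = q at hq hqp hq1 ⊢
  have h6 : x ≤ (1 + r) * (1 - q) := by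
    have ha : 2 + 2 * x + x ^ 2 ≤ (1 + r) * (2 + x) := by nlinarith
    have hb : x * (2 + x) ≤ (1 - q) * (2 + 2 * x + x ^ 2) := by nlinarith
    have hc : x * (2 + x) ≤ (1 + r) * (1 - q) * (2 + x) := by
      have := mul_le_mul_of_nonneg_left ha (by linarith : 0 ≤ 1 - q)
      nlinarith
    exact le_of_mul_le_mul_right hc (by positivity)
  have h7 := mul_le_mul_of_nonneg_left h6 hKpos.le
  rw [← hK]
  nlinarith

lemma aux_scalar (mu C e₀ G T : ℝ) (hmu : 0 < mu) (hC : 0 < C) (he : 0 < e₀)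
    (hG : G = √3 * e₀ * mu / C) (hT : 0 < T)
    (hTG : T ≤ G * (√(1 + (mu * G / 4) ^ 2) - mu * G / 4)) :
    e₀ * exp (-(mu * T)) + C / mu ^ 2 * (mu * T - 1 + exp (-(mu * T))) ≤ e₀ := by
  have hx : 0 < mu * T := by positivity
  obtain ⟨r, hr⟩ : ∃ r, r = e₀ * mu ^ 2 / C := ⟨_, rfl⟩
  have hrpos : 0 < r := by rw [hr]; positivity
  have hGpos : 0 < G := by rw [hG]; positivity
  have hg : mu * G = √3 * r := by rw [hG, hr]; field_simp
  have hxg : mu * T ≤ (mu * G) * (√(1 + (mu * G / 4) ^ 2) - mu * G / 4) := by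
    calc mu * T ≤ mu * (G * (√(1 + (mu * G / 4) ^ 2) - mu * G / 4)) := by gcongr
      _ = _ := by ring
  have hgp : 0 < mu * G := by positivity
  have hg2 : (mu * G) ^ 2 = 3 * r ^ 2 := by
    rw [hg, mul_pow, Real.sq_sqrt (by norm_num)]
  have hK : C / mu ^ 2 * r = e₀ := by rw [hr]; field_simp
  have hKpos : 0 < C / mu ^ 2 := by positivity
  exact aux_core (mu * T) (mu * G) r (C / mu ^ 2) e₀ hx hrpos hgp hxg hg2 hK hKpos

/-- Subsampling: with a negative OSL constant and an elementary time step
`Δt ≤ G·(1 − α)`, the error of the iterated explicit Euler scheme never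
exceeds the initial error bound `e₀` at each step. -/
theorem euler_subsampling_error_bound {M : ℕ}
    (S : Set (EuclideanSpace ℝ (Fin M)))
    (hSconv : Convex ℝ S) (hScomp : IsCompact S)
    (f : EuclideanSpace ℝ (Fin M) → EuclideanSpace ℝ (Fin M))
    (L lam C : ℝ) (hlam : lam < 0)
    (hLip : ∀ y₁ ∈ S, ∀ y₂ ∈ S, ‖f y₁ - f y₂‖ ≤ L * ‖y₁ - y₂‖)
    (hOSL : ∀ y₁ ∈ S, ∀ y₂ ∈ S,
      ⟪f y₁ - f y₂, y₁ - y₂⟫ ≤ lam * ‖y₁ - y₂‖ ^ 2)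
    (hC : IsLUB ((fun y => L * ‖f y‖) '' S) C)
    (e₀ : ℝ) (he₀ : 0 < e₀) (G α Δt : ℝ)
    (hG : G = Real.sqrt 3 * e₀ * |lam| / C)
    (hα : α = 1 + |lam| * G / 4 - Real.sqrt (1 + (lam * G / 4) ^ 2))
    (hsmall : |lam| * G / 4 < 1)
    (hΔt : 0 < Δt) (hΔt' : Δt ≤ G * (1 - α))
    (n : ℕ) (y : ℝ → EuclideanSpace ℝ (Fin M))
    (z : ℕ → EuclideanSpace ℝ (Fin M))
    (hyS : ∀ t ∈ Icc (0 : ℝ) (n * Δt), y t ∈ S)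
    (hy' : ∀ t ∈ Icc (0 : ℝ) (n * Δt), HasDerivAt y (f (y t)) t)
    (hz : ∀ j < n, z (j + 1) = z j + Δt • f (z j))
    (hzS : ∀ j ≤ n, z j ∈ S)
    (h0 : ‖y 0 - z 0‖ ≤ e₀) :
    ∀ j ≤ n, ‖y (j * Δt) - z j‖ ≤ e₀ := by
  have habs : |lam| = -lam := abs_of_neg hlam
  have hmu : 0 < -lam := by linarith
  have h1a : 0 < 1 - α := by
    have : |lam * G / 4| < √(1 + (lam * G / 4) ^ 2) := by
      rw [← Real.sqrt_sq_eq_abs]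
      exact Real.sqrt_lt_sqrt (sq_nonneg _) (by linarith)
    have h2 := neg_abs_le (lam * G / 4)
    rw [hα, habs]
    linarith
  have hGpos : 0 < G := by
    by_contra hcon
    push Not at hcon
    nlinarith
  have hCpos : 0 < C := by
    by_contra hcon
    push Not at hcon
    have : G ≤ 0 := by
      rw [hG]
      exact div_nonpos_of_nonneg_of_nonpos (by positivity) hcon
    linarith
  have hsc := aux_scalar (-lam) C e₀ G Δt hmu hCpos he₀ (by rw [hG, habs]) hΔt (by
    refine hΔt'.trans (le_of_eq ?_)
    rw [hα, habs]
    have : (-lam * G / 4) ^ 2 = (lam * G / 4) ^ 2 := by ring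
    rw [this]; ring)
  intro j
  induction j with
  | zero => intro _; simpa using h0
  | succ j ih =>
    intro hj
    have hj' : j < n := hj
    have ihj := ih hj'.le
    have hjn : ((j : ℝ) + 1) ≤ n := by exact_mod_cast hj
    have hmem : ∀ t ∈ Icc (0 : ℝ) Δt, j * Δt + t ∈ Icc (0 : ℝ) (n * Δt) := by
      intro t ht
      refine ⟨by have := ht.1; positivity, ?_⟩
      have := ht.2
      nlinarith
    have hzmem : ∀ t ∈ Icc (0 : ℝ) Δt, z j + t • f (z j) ∈ S := by
      intro t ht
      have h1 := hSconv.add_smul_sub_mem (hzS j hj'.le) (hzS (j + 1) hj)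
        (t := t / Δt) ⟨div_nonneg ht.1 hΔt.le, (div_le_one hΔt).2 ht.2⟩
      rw [hz j hj', add_sub_cancel_left, smul_smul, div_mul_cancel₀ _ hΔt.ne'] at h1
      exact h1
    have hb := aux_norm_le (fun t => y (j * Δt + t) - (z j + t • f (z j)))
      (fun t => f (y (j * Δt + t)) - f (z j)) Δt (-lam) C e₀ hΔt.le hmu hCpos.le he₀
      (by
        intro t ht
        have h1 := (hy' _ (hmem t ht)).comp_const_add (j * Δt) t
        have h2 := ((hasDerivAt_id t).smul_const (f (z j))).const_add (z j)
        have h3 := h1.fun_sub h2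
        simp only [one_smul] at h3
        exact h3)
      (by
        intro t ht
        have hy1 := hyS _ (hmem t ht)
        have hz1 := hzmem t ht
        have h1 := hOSL _ hy1 _ hz1
        have h2 := hLip _ hz1 _ (hzS j hj'.le)
        have h3 : L * ‖f (z j)‖ ≤ C := hC.1 ⟨z j, hzS j hj'.le, rfl⟩
        rw [add_sub_cancel_left, norm_smul, Real.norm_of_nonneg ht.1] at h2
        have h4 : ‖f (z j + t • f (z j)) - f (z j)‖ ≤ C * t := by
          have := mul_le_mul_of_nonneg_right h3 ht.1
          linarith
        have h5 := real_inner_le_norm (f (z j + t • f (z j)) - f (z j))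
          (y (j * Δt + t) - (z j + t • f (z j)))
        have h6 := mul_le_mul_of_nonneg_right h4
          (norm_nonneg (y (j * Δt + t) - (z j + t • f (z j))))
        have h7 : f (y (j * Δt + t)) - f (z j) =
          (f (y (j * Δt + t)) - f (z j + t • f (z j))) +
            (f (z j + t • f (z j)) - f (z j)) := by abel
        simp only [neg_neg]
        rw [h7, inner_add_left]
        linarith)
      (by simpa using ihj)
    have hfin := hb.trans hsc
    have hjc : ((j + 1 : ℕ) : ℝ) * Δt = j * Δt + Δt := by push_cast; ring
    rw [hjc, hz j hj']
    exact hfin
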